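/- arXiv:quant-ph/0703256 — 5 statements merged into one kernel-verified Lean document; each statement's English description precedes it below -/
import Mathlib

section
/- Let k ≥ 1 and let G be a connected simple graph on a finite vertex set V with |V| = n ≥ 2 in which every vertex has degree at most k. Then there exists a subset S ⊆ V such that S and V \ S are both nonempty, the subgraphs of G induced on S and on V \ S are both connected, and k·|S| ≥ n − 1 and k·(n − |S|) ≥ n − 1 (i.e., each side of the partition contains at least (n−1)/k and at most n − (n−1)/k vertices). -/
open Finset

namespace SimpleGraph

variable {V : Type*} {G : SimpleGraph V}

/-- The vertex set of the connected component of `x` in the subgraph induced on `s`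
(empty if `x ∉ s`). -/
def componentIn (G : SimpleGraph V) (s : Set V) (x : V) : Set V :=
  ⋃₀ {t | t ⊆ s ∧ x ∈ t ∧ (G.induce t).Connected}

lemma componentIn_subset (s : Set V) (x : V) : G.componentIn s x ⊆ s :=
  Set.sUnion_subset fun _ ht => ht.1

lemma subset_componentIn {s t : Set V} {x : V} (hts : t ⊆ s) (hx : x ∈ t)
    (ht : (G.induce t).Connected) : t ⊆ G.componentIn s x :=
  Set.subset_sUnion_of_mem ⟨hts, hx, ht⟩

lemma connected_induce_singleton (x : V) : (G.induce {x}).Connected := by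
  have : Nonempty ({x} : Set V) := ⟨⟨x, rfl⟩⟩
  exact ⟨Preconnected.of_subsingleton⟩

lemma mem_componentIn {s : Set V} {x : V} (hx : x ∈ s) : x ∈ G.componentIn s x :=
  subset_componentIn (Set.singleton_subset_iff.2 hx) rfl (connected_induce_singleton x) rfl

lemma connected_componentIn {s : Set V} {x : V} (hx : x ∈ s) :
    (G.induce (G.componentIn s x)).Connected := by
  refine induce_sUnion_connected_of_pairwise_not_disjoint
    ⟨{x}, Set.singleton_subset_iff.2 hx, rfl, connected_induce_singleton x⟩ ?_ ?_
  · exact fun hs ht => ⟨x, hs.2.1, ht.2.1⟩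
  · exact fun ht => ht.2.2

lemma connected_induce_insert {s : Set V} {v w : V} (hs : (G.induce s).Connected) (hw : w ∈ s)
    (h : G.Adj v w) : (G.induce (insert v s)).Connected := by
  rw [Set.insert_eq]
  exact connected_induce_union (connected_induce_singleton v).preconnected hs.preconnected rfl hw h

/-- If the subgraph induced on `s` is connected, an edge inside `s` leaves any part of `s`. -/
lemma exists_adj_of_connected_induce {s t : Set V} (hs : (G.induce s).Connected) {x y : V}
    (hx : x ∈ s) (hxt : x ∈ t) (hy : y ∈ s) (hyt : y ∉ t) :
    ∃ a ∈ s, ∃ b ∈ s, a ∈ t ∧ b ∉ t ∧ G.Adj a b := by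
  obtain ⟨p⟩ := hs.preconnected ⟨x, hx⟩ ⟨y, hy⟩
  obtain ⟨d, -, h₁, h₂⟩ := p.exists_boundary_dart (Subtype.val ⁻¹' t) hxt hyt
  exact ⟨d.fst, d.fst.2, d.snd, d.snd.2, h₁, h₂, d.adj⟩

/-- If `s` induces a connected subgraph, every component of `s \ {v}` contains a neighbour
of `v`. -/
lemma exists_mem_componentIn_adj {s : Set V} {v x : V} (hs : (G.induce s).Connected) (hv : v ∈ s)
    (hx : x ∈ s \ {v}) : ∃ y ∈ G.componentIn (s \ {v}) x, G.Adj v y := by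
  obtain ⟨a, -, b, hb, hat, hbt, hab⟩ := exists_adj_of_connected_induce hs hx.1
    (mem_componentIn (G := G) hx) hv fun h => (componentIn_subset _ _ h).2 rfl
  obtain rfl | hbv := eq_or_ne b v
  · exact ⟨a, hat, hab.symm⟩
  · refine (hbt (subset_componentIn ?_ (Set.mem_insert_of_mem b (mem_componentIn hx))
      (connected_induce_insert (connected_componentIn hx) hat hab.symm) ?_)).elim
    · exact Set.insert_subset ⟨hb, hbv⟩ (componentIn_subset _ _)
    · exact Set.mem_insert _ _

lemma componentIn_disjoint {s : Set V} {x y : V} (hx : x ∈ s) (hy : y ∈ s)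
    (hxy : x ∉ G.componentIn s y) : Disjoint (G.componentIn s x) (G.componentIn s y) := by
  rw [Set.disjoint_iff_inter_eq_empty]
  by_contra hne
  exact hxy (subset_componentIn
    (Set.union_subset (componentIn_subset s x) (componentIn_subset s y))
    (Or.inr (mem_componentIn hy))
    (induce_union_connected (connected_componentIn hx).preconnected
      (connected_componentIn hy).preconnected (Set.nonempty_iff_ne_empty.2 hne))
    (Or.inl (mem_componentIn hx)))

/-- If `s` and its complement induce connected subgraphs and `v ∉ s` has a neighbour in `s`, then
removing from the graph a component of `sᶜ \ {v}` leaves a connected graph. -/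
lemma connected_induce_compl_componentIn {s : Set V} {u v w : V} (hs : (G.induce s).Connected)
    (hsc : (G.induce sᶜ).Connected) (hu : u ∈ s) (hv : v ∈ sᶜ) (hvu : G.Adj v u)
    (hw : w ∈ sᶜ \ {v}) : (G.induce (G.componentIn (sᶜ \ {v}) w)ᶜ).Connected := by
  have hvC : v ∉ G.componentIn (sᶜ \ {v}) w := fun h => (componentIn_subset _ _ h).2 rfl
  refine induce_connected_of_patches v hvC fun {x} hx => ?_
  by_cases hxs : x ∈ sᶜ \ {v}
  · obtain ⟨y, hy, hvy⟩ := exists_mem_componentIn_adj hsc hv hxs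
    refine ⟨insert v (G.componentIn (sᶜ \ {v}) x), Set.insert_subset hvC ?_,
      Set.mem_insert _ _, Set.mem_insert_of_mem _ (mem_componentIn hxs), ?_⟩
    · exact (componentIn_disjoint hxs hw hx).subset_compl_right
    · exact (connected_induce_insert (connected_componentIn hxs) hy hvy).preconnected _ _
  · have hx' : x ∈ insert v s := by
      by_contra h
      rw [Set.mem_insert_iff, not_or] at h
      exact hxs ⟨h.2, h.1⟩
    refine ⟨insert v s, Set.insert_subset hvC ?_, Set.mem_insert _ _, hx', ?_⟩
    · exact fun y hy h => (componentIn_subset _ _ h).1 hy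
    · exact (connected_induce_insert hs hu hvu).preconnected _ _

variable [Fintype V] [DecidableEq V] [DecidableRel G.Adj]

/-- In a connected graph of maximum degree at most `k`, a connected split with one side of size
less than `(n - 1) / k` can be replaced by one whose two sides are both larger than that side. -/
lemma exists_connected_split_card_lt {k : ℕ} (hconn : G.Connected) (hdeg : ∀ v, G.degree v ≤ k)
    {A : Finset V} (hA : (G.induce (A : Set V)).Connected)
    (hAc : (G.induce ((Aᶜ : Finset V) : Set V)).Connected)
    (hcard : k * #A < Fintype.card V - 1) :
    ∃ C : Finset V, (G.induce (C : Set V)).Connected ∧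
      (G.induce ((Cᶜ : Finset V) : Set V)).Connected ∧ #A < #C ∧ #A < #Cᶜ := by
  classical
  obtain ⟨⟨a, ha⟩⟩ := hA.nonempty
  obtain ⟨⟨b, hb⟩⟩ := hAc.nonempty
  rw [coe_compl] at hAc hb
  obtain ⟨p⟩ := hconn.preconnected a b
  obtain ⟨⟨⟨u, v⟩, huv⟩, -, hu, hv⟩ := p.exists_boundary_dart (A : Set V) ha hb
  replace huv : G.Adj u v := huv
  change u ∈ (A : Set V) at hu
  change v ∈ (A : Set V)ᶜ at hv
  set s : Set V := (A : Set V)ᶜ \ {v} with hs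
  let C (w : V) : Finset V := (G.componentIn s w).toFinset
  have hC (w : V) : (C w : Set V) = G.componentIn s w := Set.coe_toFinset _
  set N := G.neighborFinset v \ A with hN
  have hNs {w : V} (hw : w ∈ N) : w ∈ s := by
    rw [hN, mem_sdiff, mem_neighborFinset] at hw
    exact ⟨hw.2, hw.1.ne'⟩
  have hNcard : #N + 1 ≤ k := by
    refine le_trans (card_lt_card ?_) ((G.card_neighborFinset_eq_degree v).trans_le (hdeg v))
    refine ⟨sdiff_subset, fun h => ?_⟩
    have := h ((G.mem_neighborFinset v u).2 huv.symm)
    exact (mem_sdiff.1 this).2 hu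
  have hcover : Aᶜ.erase v ⊆ N.biUnion C := by
    intro x hx
    have hxs : x ∈ s := by simpa [hs, and_comm] using hx
    obtain ⟨y, hy, hvy⟩ := exists_mem_componentIn_adj hAc hv hxs
    have hys := componentIn_subset _ _ hy
    refine mem_biUnion.2 ⟨y, mem_sdiff.2 ⟨(G.mem_neighborFinset v y).2 hvy, hys.1⟩, ?_⟩
    exact Set.mem_toFinset.2 (subset_componentIn (componentIn_subset s x) hy
      (connected_componentIn hxs) (mem_componentIn hxs))
  obtain ⟨w, hw, hlt⟩ : ∃ w ∈ N, #A < #(C w) := by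
    by_contra! h
    have h₁ := (card_le_card hcover).trans (card_biUnion_le_card_mul N C #A h)
    rw [card_erase_of_mem (by simpa using hv), card_compl] at h₁
    have h₂ := Nat.mul_le_mul_right #A hNcard
    rw [add_mul] at h₂
    omega
  refine ⟨C w, ?_, ?_, hlt, ?_⟩
  · rw [hC]
    exact connected_componentIn (hNs hw)
  · rw [coe_compl, hC]
    exact connected_induce_compl_componentIn hA hAc hu hv huv.symm (hNs hw)
  · have hsub : insert v A ⊆ (C w)ᶜ := by
      refine fun x hx => mem_compl.2 fun hxC => ?_
      have := componentIn_subset _ _ (Set.mem_toFinset.1 hxC)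
      rcases mem_insert.1 hx with rfl | hxA
      · exact this.2 rfl
      · exact this.1 hxA
    have := card_le_card hsub
    rw [card_insert_of_notMem (by simpa using hv)] at this
    omega

end SimpleGraph

/-- A connected graph on `n ≥ 2` vertices with maximum degree at most `k ≥ 1`
admits a split into two nonempty, connected induced parts, each of size at least `(n-1)/k`
(equivalently at most `n - (n-1)/k`). -/
theorem bounded_degree_connected_split
    {V : Type} [Fintype V] [DecidableEq V]
    (G : SimpleGraph V) [DecidableRel G.Adj]
    (k : ℕ) (hk : 1 ≤ k)
    (hconn : G.Connected)
    (hdeg : ∀ v : V, G.degree v ≤ k)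
    (hn : 2 ≤ Fintype.card V) :
    ∃ S : Finset V,
      S.Nonempty ∧ Sᶜ.Nonempty ∧
      (G.induce (S : Set V)).Connected ∧
      (G.induce ((Sᶜ : Finset V) : Set V)).Connected ∧
      Fintype.card V - 1 ≤ k * S.card ∧
      Fintype.card V - 1 ≤ k * (Fintype.card V - S.card) := by
  classical
  have : Nontrivial V := Fintype.one_lt_card_iff_nontrivial.1 hn
  obtain ⟨v, hv⟩ := hconn.exists_connected_induce_compl_singleton_of_finite_nontrivial
  let splits : Finset (Finset V) := {S | (G.induce (S : Set V)).Connected ∧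
    (G.induce ((Sᶜ : Finset V) : Set V)).Connected}
  have hne : splits.Nonempty := by
    refine ⟨{v}, mem_filter.2 ⟨mem_univ _, ?_, ?_⟩⟩
    · rw [coe_singleton]
      exact SimpleGraph.connected_induce_singleton v
    · rw [coe_compl, coe_singleton]
      exact hv
  obtain ⟨S, hS, hmax⟩ := splits.exists_max_image (fun S => min #S #Sᶜ) hne
  obtain ⟨-, hS, hSc⟩ := mem_filter.1 hS
  have hnot (A : Finset V) (hA : (G.induce (A : Set V)).Connected)
      (hAc : (G.induce ((Aᶜ : Finset V) : Set V)).Connected) (hle : min #S #Sᶜ ≤ #A) :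
      Fintype.card V - 1 ≤ k * #A := by
    by_contra! h
    obtain ⟨C, hC, hCc, h₁, h₂⟩ :=
      SimpleGraph.exists_connected_split_card_lt hconn hdeg hA hAc h
    exact (hle.trans_lt (lt_min h₁ h₂)).not_ge
      (hmax C (mem_filter.2 ⟨mem_univ _, hC, hCc⟩))
  refine ⟨S, ?_, ?_, hS, hSc, hnot S hS hSc (min_le_left _ _), ?_⟩
  · exact coe_nonempty.1 (Set.nonempty_coe_sort.1 hS.nonempty)
  · exact coe_nonempty.1 (Set.nonempty_coe_sort.1 hSc.nonempty)
  · rw [← card_compl]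
    exact hnot Sᶜ hSc (by rwa [compl_compl]) (min_le_right _ _)
end

section
/- Let k ≥ 1. Every finite connected simple graph G in which every vertex has degree at most k is well separable with parameter s = 1/k. -/
/-- A finset `U` of vertices of `G` is *well separable* with parameter `s` if either it has at
most one element, or it can be partitioned into nonempty sets `A` and `B` such that the
subgraphs of `G` induced on `A` and on `B` are connected,
`s * max (|A|, |B|) ≤ min (|A|, |B|)`, and both parts are again well separable. -/
inductive WellSep {V : Type} [Fintype V] [DecidableEq V]
    (G : SimpleGraph V) (s : ℝ) : Finset V → Prop
  | small (U : Finset V) (h : U.card ≤ 1) : WellSep G s U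
  | split (U A B : Finset V)
      (hA : A.Nonempty) (hB : B.Nonempty)
      (hdisj : Disjoint A B) (hunion : A ∪ B = U)
      (hconnA : (G.induce (A : Set V)).Connected)
      (hconnB : (G.induce (B : Set V)).Connected)
      (hratio : s * (max A.card B.card : ℝ) ≤ (min A.card B.card : ℝ))
      (hWA : WellSep G s A) (hWB : WellSep G s B) :
      WellSep G s U

namespace SimpleGraph

variable {V : Type*} {G : SimpleGraph V}

/-- A set is connected as soon as one of its points can be joined to every other by a walk staying
inside the set. -/
lemma induce_connected_of_forall_exists_walk {s : Set V} {u : V} (hu : u ∈ s)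
    (h : ∀ v ∈ s, ∃ p : G.Walk u v, ∀ w ∈ p.support, w ∈ s) : (G.induce s).Connected := by
  refine G.induce_connected_of_patches u hu fun {v} hv ↦ ?_
  obtain ⟨p, hp⟩ := h v hv
  exact ⟨{w | w ∈ p.support}, hp, p.start_mem_support, p.end_mem_support,
    p.connected_induce_support.preconnected _ _⟩

/-- Any two vertices of a connected set are joined by a path staying inside the set. -/
lemma Connected.exists_isPath_of_induce {s : Set V} (h : (G.induce s).Connected) {u v : V}
    (hu : u ∈ s) (hv : v ∈ s) : ∃ p : G.Walk u v, p.IsPath ∧ ∀ w ∈ p.support, w ∈ s := by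
  classical
  obtain ⟨q⟩ := h.preconnected ⟨u, hu⟩ ⟨v, hv⟩
  refine ⟨(q.map (Embedding.induce s).toHom).bypass, Walk.bypass_isPath _, fun w hw ↦ ?_⟩
  have hw := Walk.support_bypass_subset_support _ hw
  obtain ⟨z, -, rfl⟩ := List.mem_map.1 (Walk.support_map _ q ▸ hw)
  exact z.2

section Split

variable [DecidableEq V]

/-- `A` and its complement in `U` form a partition of `U` into nonempty connected sets. -/
structure IsConnectedSplit (G : SimpleGraph V) (U A : Finset V) : Prop where
  subset : A ⊆ U
  left : (G.induce (A : Set V)).Connected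
  right : (G.induce ((U \ A : Finset V) : Set V)).Connected

namespace IsConnectedSplit

variable {U A : Finset V}

lemma symm (h : G.IsConnectedSplit U A) : G.IsConnectedSplit U (U \ A) where
  subset := Finset.sdiff_subset
  left := h.right
  right := by rw [Finset.sdiff_sdiff_eq_self h.subset]; exact h.left

lemma nonempty (h : G.IsConnectedSplit U A) : A.Nonempty := by
  obtain ⟨⟨x, hx⟩⟩ := h.left.nonempty
  exact ⟨x, hx⟩

end IsConnectedSplit

end Split

variable [Fintype V]

open Classical in
/-- The vertices that can be reached from `x` by a walk staying inside `s`. -/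
noncomputable def reachableWithin (G : SimpleGraph V) (s : Finset V) (x : V) : Finset V :=
  {v | ∃ p : G.Walk x v, ∀ w ∈ p.support, w ∈ s}

lemma mem_reachableWithin {s : Finset V} {x v : V} :
    v ∈ G.reachableWithin s x ↔ ∃ p : G.Walk x v, ∀ w ∈ p.support, w ∈ s := by
  simp [reachableWithin]

lemma self_mem_reachableWithin {s : Finset V} {x : V} (hx : x ∈ s) :
    x ∈ G.reachableWithin s x :=
  mem_reachableWithin.2 ⟨.nil, by simpa⟩

lemma reachableWithin_subset (s : Finset V) (x : V) : G.reachableWithin s x ⊆ s := fun _ hv ↦ by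
  obtain ⟨p, hp⟩ := mem_reachableWithin.1 hv
  exact hp _ p.end_mem_support

/-- `reachableWithin` is closed under walks staying inside the ambient set. -/
lemma mem_reachableWithin_trans {s : Finset V} {x u v : V} (hu : u ∈ G.reachableWithin s x)
    (p : G.Walk u v) (hp : ∀ w ∈ p.support, w ∈ s) : v ∈ G.reachableWithin s x := by
  obtain ⟨q, hq⟩ := mem_reachableWithin.1 hu
  refine mem_reachableWithin.2 ⟨q.append p, fun w hw ↦ ?_⟩
  rcases (Walk.mem_support_append_iff q p).1 hw with h | h
  exacts [hq w h, hp w h]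

lemma induce_reachableWithin_connected {s : Finset V} {x : V} (hx : x ∈ s) :
    (G.induce (G.reachableWithin s x : Set V)).Connected := by
  classical
  refine induce_connected_of_forall_exists_walk (u := x) (self_mem_reachableWithin hx) ?_
  intro v hv
  obtain ⟨p, hp⟩ := mem_reachableWithin.1 hv
  exact ⟨p, fun w hw ↦ mem_reachableWithin.2
    ⟨p.takeUntil w hw, fun z hz ↦ hp z (p.support_takeUntil_subset_support hw hz)⟩⟩

variable [DecidableEq V]

/-- In a connected set `A`, every vertex other than `a` can be reached from a neighbour of `a`
without passing through `a`. -/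
lemma Connected.exists_adj_mem_reachableWithin_erase {A : Finset V}
    (hA : (G.induce (A : Set V)).Connected) {a v : V} (ha : a ∈ A) (hv : v ∈ A) (hne : v ≠ a) :
    ∃ x ∈ A, G.Adj a x ∧ v ∈ G.reachableWithin (A.erase a) x := by
  obtain ⟨p, hp, hpA⟩ := hA.exists_isPath_of_induce (Finset.mem_coe.2 ha) (Finset.mem_coe.2 hv)
  cases p with
  | nil => exact absurd rfl hne
  | @cons _ x _ hadj q =>
    rw [Walk.cons_isPath_iff] at hp
    have hq : ∀ w ∈ q.support, w ∈ A := fun w hw ↦ by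
      simpa using hpA w (by simp [Walk.support_cons, hw])
    refine ⟨x, hq x q.start_mem_support, hadj, mem_reachableWithin.2 ⟨q, fun w hw ↦ ?_⟩⟩
    exact Finset.mem_erase.2 ⟨fun h ↦ hp.2 (h ▸ hw), hq w hw⟩

/-- If `A ⊆ U` is connected and `a ∈ A` can be joined to all of `U \ A` without using other
vertices of `A`, then removing from `U` a component of `A \ {a}` leaves a connected set. -/
lemma induce_sdiff_reachableWithin_connected {U A : Finset V} (hAU : A ⊆ U)
    (hA : (G.induce (A : Set V)).Connected) {a : V} (ha : a ∈ A)
    (hB : ∀ v ∈ U \ A, ∃ p : G.Walk a v, ∀ w ∈ p.support, w ∈ insert a (U \ A)) (x : V) :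
    (G.induce ((U \ G.reachableWithin (A.erase a) x : Finset V) : Set V)).Connected := by
  have hsub := G.reachableWithin_subset (A.erase a) x
  have haC : a ∈ U \ G.reachableWithin (A.erase a) x :=
    Finset.mem_sdiff.2 ⟨hAU ha, fun h ↦ by simpa using hsub h⟩
  refine induce_connected_of_forall_exists_walk (Finset.mem_coe.2 haC) fun v hv ↦ ?_
  obtain ⟨hvU, hvC⟩ := Finset.mem_sdiff.1 (Finset.mem_coe.1 hv)
  by_cases hvA : v ∈ A
  · by_cases hva : v = a
    · subst hva
      exact ⟨.nil, by simpa using haC⟩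
    obtain ⟨y, hyA, hay, hy⟩ := hA.exists_adj_mem_reachableWithin_erase ha hvA hva
    obtain ⟨p, hp⟩ := mem_reachableWithin.1 hy
    refine ⟨.cons hay p, fun w hw ↦ ?_⟩
    rw [Walk.support_cons, List.mem_cons] at hw
    rcases hw with rfl | hw
    · exact haC
    refine Finset.mem_coe.2 (Finset.mem_sdiff.2 ⟨hAU (Finset.mem_of_mem_erase (hp w hw)), ?_⟩)
    intro hwC
    exact hvC (mem_reachableWithin_trans hwC (p.dropUntil w hw)
      fun z hz ↦ hp z (p.support_dropUntil_subset_support hw hz))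
  · obtain ⟨p, hp⟩ := hB v (Finset.mem_sdiff.2 ⟨hvU, hvA⟩)
    refine ⟨p, fun w hw ↦ ?_⟩
    rcases Finset.mem_insert.1 (hp w hw) with rfl | h
    · exact haC
    · obtain ⟨hwU, hwA⟩ := Finset.mem_sdiff.1 h
      exact Finset.mem_coe.2 (Finset.mem_sdiff.2
        ⟨hwU, fun h ↦ hwA (Finset.mem_of_mem_erase (hsub h))⟩)

lemma Connected.exists_isConnectedSplit {U : Finset V} (hU : (G.induce (U : Set V)).Connected)
    (hcard : 1 < U.card) : ∃ A, G.IsConnectedSplit U A := by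
  obtain ⟨a, ha, x, hx, hne⟩ := Finset.one_lt_card.1 hcard
  exact ⟨G.reachableWithin (U.erase a) x,
    (reachableWithin_subset _ _).trans (Finset.erase_subset _ _),
    induce_reachableWithin_connected (Finset.mem_erase.2 ⟨hne.symm, hx⟩),
    induce_sdiff_reachableWithin_connected subset_rfl hU ha (by simp) x⟩

/-- A connected set with at least two vertices in a graph of maximum degree at most `k` splits into
two connected parts, the larger being at most `k` times the smaller. -/
lemma Connected.exists_isConnectedSplit_card_le [DecidableRel G.Adj] {k : ℕ}
    (hdeg : ∀ v, G.degree v ≤ k) {U : Finset V} (hU : (G.induce (U : Set V)).Connected)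
    (hcard : 1 < U.card) :
    ∃ A, G.IsConnectedSplit U A ∧ (U \ A).card ≤ A.card ∧ A.card ≤ k * (U \ A).card := by
  classical
  obtain ⟨A₀, hA₀, hmin₀⟩ := Set.exists_min_image {A | G.IsConnectedSplit U A}
    (fun A ↦ max A.card (U \ A).card) (Set.toFinite _) (hU.exists_isConnectedSplit hcard)
  obtain ⟨A, hA, hle, hmin⟩ : ∃ A, G.IsConnectedSplit U A ∧ (U \ A).card ≤ A.card ∧
      ∀ C, G.IsConnectedSplit U C → A.card ≤ max C.card (U \ C).card := by
    rcases le_total (U \ A₀).card A₀.card with h | h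
    · exact ⟨A₀, hA₀, h, fun C hC ↦ (le_max_left _ _).trans (hmin₀ C hC)⟩
    · refine ⟨U \ A₀, hA₀.symm, ?_, fun C hC ↦ (le_max_right _ _).trans (hmin₀ C hC)⟩
      rwa [Finset.sdiff_sdiff_eq_self hA₀.subset]
  refine ⟨A, hA, hle, ?_⟩
  obtain ⟨a, ha, b, hb, hab⟩ : ∃ a ∈ A, ∃ b ∈ U \ A, G.Adj a b := by
    obtain ⟨u, hu⟩ := hA.nonempty
    obtain ⟨v, hv⟩ := hA.symm.nonempty
    obtain ⟨p, -, hpU⟩ := hU.exists_isPath_of_induce (Finset.mem_coe.2 (hA.subset hu))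
      (Finset.mem_coe.2 (Finset.sdiff_subset hv))
    obtain ⟨d, hd, hd₁, hd₂⟩ := p.exists_boundary_dart (A : Set V) hu
      (fun h ↦ (Finset.mem_sdiff.1 hv).2 h)
    exact ⟨d.fst, hd₁, d.snd, Finset.mem_sdiff.2
      ⟨hpU _ (p.dart_snd_mem_support_of_mem_darts hd), hd₂⟩, d.adj⟩
  have hB : ∀ v ∈ U \ A, ∃ p : G.Walk a v, ∀ w ∈ p.support, w ∈ insert a (U \ A) := by
    intro v hv
    obtain ⟨p, -, hp⟩ := hA.right.exists_isPath_of_induce (Finset.mem_coe.2 hb)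
      (Finset.mem_coe.2 hv)
    refine ⟨.cons hab p, fun w hw ↦ ?_⟩
    rw [Walk.support_cons, List.mem_cons] at hw
    exact Finset.mem_insert.2 (hw.imp id fun h ↦ Finset.mem_coe.1 (hp w h))
  have hcomp : ∀ x ∈ G.neighborFinset a ∩ A,
      (G.reachableWithin (A.erase a) x).card ≤ (U \ A).card := by
    intro x hx
    obtain ⟨hax, hxA⟩ := Finset.mem_inter.1 hx
    rw [mem_neighborFinset] at hax
    have hsub := G.reachableWithin_subset (A.erase a) x
    have hCU : G.reachableWithin (A.erase a) x ⊆ U :=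
      hsub.trans ((Finset.erase_subset _ _).trans hA.subset)
    have hC := hmin _ ⟨hCU,
      induce_reachableWithin_connected (Finset.mem_erase.2 ⟨hax.ne', hxA⟩),
      induce_sdiff_reachableWithin_connected hA.subset hA.left ha hB x⟩
    have h₁ := Finset.card_le_card hsub
    have h₂ := Finset.card_erase_lt_of_mem ha
    have h₃ := Finset.card_sdiff_add_card_eq_card hA.subset
    have h₄ := Finset.card_sdiff_add_card_eq_card hCU
    omega
  have hcover : A.erase a ⊆
      (G.neighborFinset a ∩ A).biUnion (G.reachableWithin (A.erase a)) := by
    intro v hv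
    obtain ⟨hne, hvA⟩ := Finset.mem_erase.1 hv
    obtain ⟨x, hx, hax, hvx⟩ := hA.left.exists_adj_mem_reachableWithin_erase ha hvA hne
    exact Finset.mem_biUnion.2 ⟨x, by simp [hx, hax], hvx⟩
  have hnbr : (G.neighborFinset a ∩ A).card + 1 ≤ k := by
    refine le_trans ?_ (hdeg a)
    rw [← card_neighborFinset_eq_degree]
    refine Finset.card_lt_card (Finset.ssubset_iff_subset_ne.2 ⟨Finset.inter_subset_left, ?_⟩)
    intro h
    have hbA : b ∈ G.neighborFinset a := (mem_neighborFinset _ _ _).2 hab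
    rw [← h] at hbA
    exact (Finset.mem_sdiff.1 hb).2 (Finset.mem_inter.1 hbA).2
  have hle' := (Finset.card_le_card hcover).trans (Finset.card_biUnion_le_card_mul _ _ _ hcomp)
  have hpos := hA.symm.nonempty.card_pos
  have := Finset.card_erase_add_one ha
  calc A.card ≤ ((G.neighborFinset a ∩ A).card + 1) * (U \ A).card := by
        rw [add_mul]; omega
    _ ≤ k * (U \ A).card := Nat.mul_le_mul_right _ hnbr

end SimpleGraph

lemma wellSep_of_induce_connected {k : ℕ} (hk : 1 ≤ k) {V : Type} [Fintype V] [DecidableEq V]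
    (G : SimpleGraph V) [DecidableRel G.Adj] (hdeg : ∀ v : V, G.degree v ≤ k) (U : Finset V)
    (hU : (G.induce (U : Set V)).Connected) : WellSep G (1 / (k : ℝ)) U := by
  induction U using Finset.strongInduction with
  | H U ih =>
    rcases le_or_gt U.card 1 with h | h
    · exact .small U h
    obtain ⟨A, hA, hle, hbal⟩ := hU.exists_isConnectedSplit_card_le hdeg h
    have hAU : A ⊂ U := by
      refine Finset.ssubset_iff_subset_ne.2 ⟨hA.subset, ?_⟩
      rintro rfl
      simpa using hA.symm.nonempty
    refine .split U A (U \ A) hA.nonempty hA.symm.nonempty Finset.disjoint_sdiff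
      (Finset.union_sdiff_of_subset hA.subset) hA.left hA.right ?_ (ih A hAU hA.left)
      (ih _ (Finset.sdiff_ssubset hA.subset hA.nonempty) hA.right)
    have hk₀ : (0 : ℝ) < k := by exact_mod_cast hk
    rw [max_eq_left (by exact_mod_cast hle), min_eq_right (by exact_mod_cast hle),
      one_div, inv_mul_le_iff₀ hk₀]
    exact_mod_cast hbal

/-- every finite connected simple graph of maximum degree at most `k ≥ 1`
is well separable with parameter `1/k`. -/
theorem bounded_degree_wellSep
    (k : ℕ) (hk : 1 ≤ k)
    {V : Type} [Fintype V] [DecidableEq V]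
    (G : SimpleGraph V) [DecidableRel G.Adj]
    (hconn : G.Connected)
    (hdeg : ∀ v : V, G.degree v ≤ k) :
    WellSep G (1 / (k : ℝ)) Finset.univ := by
  refine wellSep_of_induce_connected hk G hdeg _ ?_
  rw [Finset.coe_univ]
  exact (SimpleGraph.induceUnivIso G).connected_iff.2 hconn
end

section
/- Let n ≥ 2 and let P_n be the path graph with vertex set {1, 2, …, n} and edges {i, i+1} for 1 ≤ i ≤ n−1. If the transposition exchanging vertices 1 and n (i.e., the permutation (n, 2, 3, …, n−1, 1)) is written as a product of t swap rounds of P_n, then t ≥ n − 1. Hence any procedure realizing arbitrary permutations on the chain nearest-neighbor architecture requires a number of rounds at least linear in n in the worst case. -/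
/-- A *swap round* of a graph `G` is a permutation of its vertices that is a product of
transpositions along pairwise disjoint edges of `G`; equivalently, an involution that moves
every non-fixed vertex to an adjacent vertex. -/
def IsSwapRound {V : Type} (G : SimpleGraph V) (σ : Equiv.Perm V) : Prop :=
  (∀ v : V, σ (σ v) = v) ∧ ∀ v : V, σ v = v ∨ G.Adj v (σ v)

/-- A swap round of the path graph moves every vertex up by at most one position. -/
theorem IsSwapRound.val_apply_le {n : ℕ} {σ : Equiv.Perm (Fin n)}
    (hσ : IsSwapRound (SimpleGraph.pathGraph n) σ) (v : Fin n) :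
    (σ v).val ≤ v.val + 1 := by
  rcases hσ.2 v with h | h
  · rw [h]
    omega
  · rw [SimpleGraph.pathGraph_adj] at h
    omega

/-- A product of swap rounds of the path graph moves every vertex up by at most as many
positions as there are rounds. -/
theorem val_prod_swapRounds_apply_le {n : ℕ} (L : List (Equiv.Perm (Fin n)))
    (hL : ∀ σ ∈ L, IsSwapRound (SimpleGraph.pathGraph n) σ) (v : Fin n) :
    (L.prod v).val ≤ v.val + L.length := by
  induction L with
  | nil => simp
  | cons σ L ih =>
    have hhead := (hL σ List.mem_cons_self).val_apply_le (L.prod v)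
    have htail := ih fun τ hτ => hL τ (List.mem_cons_of_mem σ hτ)
    rw [List.prod_cons, Equiv.Perm.mul_apply, List.length_cons]
    omega

/-- on the path graph with `n ≥ 2` vertices, writing the transposition of the
two endpoints as a product of `t` swap rounds forces `t ≥ n - 1`. -/
theorem swap_endpoints_path_lower_bound
    (n : ℕ) (hn : 2 ≤ n)
    (L : List (Equiv.Perm (Fin n)))
    (hL : ∀ σ ∈ L, IsSwapRound (SimpleGraph.pathGraph n) σ)
    (hprod : L.prod = Equiv.swap (⟨0, by omega⟩ : Fin n) (⟨n - 1, by omega⟩ : Fin n)) :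
    n - 1 ≤ L.length := by
  have h := val_prod_swapRounds_apply_le L hL ⟨0, by omega⟩
  rw [hprod, Equiv.swap_apply_left] at h
  simpa using h
end

section
/- For all m, n ≥ 1, the m × n grid graph (the graph on vertex set {1,…,m} × {1,…,n} in which two vertices are adjacent exactly when they agree in one coordinate and differ by 1 in the other) is well separable with parameter 1/2. -/
/-- The `m × n` grid graph: vertices are pairs `(i, j) ∈ Fin m × Fin n`, and two vertices are
adjacent exactly when they agree in one coordinate and differ by `1` in the other. -/
def gridGraph (m n : ℕ) : SimpleGraph (Fin m × Fin n) :=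
  SimpleGraph.fromRel (fun p q =>
    (p.1 = q.1 ∧ (p.2 : ℕ) + 1 = (q.2 : ℕ)) ∨ (p.2 = q.2 ∧ (p.1 : ℕ) + 1 = (q.1 : ℕ)))

/-- The indices `i : Fin k` with `a ≤ i < b`. -/
def finInterval (k a b : ℕ) : Finset (Fin k) :=
  Finset.univ.filter fun i => a ≤ (i : ℕ) ∧ (i : ℕ) < b

theorem mem_finInterval {k a b : ℕ} {i : Fin k} :
    i ∈ finInterval k a b ↔ a ≤ (i : ℕ) ∧ (i : ℕ) < b := by
  simp [finInterval]

theorem card_finInterval {k a b : ℕ} (hb : b ≤ k) : (finInterval k a b).card = b - a := by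
  rw [← Finset.card_map Fin.valEmbedding, ← Nat.card_Ico]
  congr 1
  ext x
  simp only [Finset.mem_map, mem_finInterval, Fin.valEmbedding_apply, Finset.mem_Ico]
  exact ⟨fun ⟨i, hi, h⟩ => h ▸ hi, fun h => ⟨⟨x, by omega⟩, h, rfl⟩⟩

theorem finInterval_union {k a b c : ℕ} (hab : a ≤ b) (hbc : b ≤ c) :
    finInterval k a b ∪ finInterval k b c = finInterval k a c := by
  ext i
  simp only [Finset.mem_union, mem_finInterval]
  omega

theorem disjoint_finInterval (k a b c : ℕ) :
    Disjoint (finInterval k a b) (finInterval k b c) := by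
  rw [Finset.disjoint_left]
  intro i h h'
  rw [mem_finInterval] at h h'
  omega

/-- The vertices of the `m × n` grid in the rectangle `[a, b) × [c, d)`. -/
def gridRect (m n a b c d : ℕ) : Finset (Fin m × Fin n) :=
  finInterval m a b ×ˢ finInterval n c d

theorem mem_gridRect {m n a b c d : ℕ} {p : Fin m × Fin n} :
    p ∈ gridRect m n a b c d ↔ (a ≤ (p.1 : ℕ) ∧ (p.1 : ℕ) < b) ∧ c ≤ (p.2 : ℕ) ∧ (p.2 : ℕ) < d := by
  simp [gridRect, mem_finInterval]

theorem card_gridRect {m n a b c d : ℕ} (hb : b ≤ m) (hd : d ≤ n) :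
    (gridRect m n a b c d).card = (b - a) * (d - c) := by
  rw [gridRect, Finset.card_product, card_finInterval hb, card_finInterval hd]

theorem gridRect_nonempty {m n a b c d : ℕ} (hab : a < b) (hb : b ≤ m) (hcd : c < d) (hd : d ≤ n) :
    (gridRect m n a b c d).Nonempty :=
  ⟨(⟨a, by omega⟩, ⟨c, by omega⟩), by simp [mem_gridRect, hab, hcd]⟩

theorem gridGraph_adj_fst {m n i : ℕ} (hi : i + 1 < m) (y : Fin n) :
    (gridGraph m n).Adj (⟨i + 1, hi⟩, y) (⟨i, by omega⟩, y) := by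
  simp [gridGraph]

theorem gridGraph_adj_snd {m n j : ℕ} (x : Fin m) (hj : j + 1 < n) :
    (gridGraph m n).Adj (x, ⟨j + 1, hj⟩) (x, ⟨j, by omega⟩) := by
  simp [gridGraph]

theorem gridRect_connected {m n a b c d : ℕ} (hab : a < b) (hb : b ≤ m) (hcd : c < d)
    (hd : d ≤ n) :
    ((gridGraph m n).induce (gridRect m n a b c d : Set (Fin m × Fin n))).Connected := by
  have corner : ((⟨a, by omega⟩, ⟨c, by omega⟩) : Fin m × Fin n) ∈ gridRect m n a b c d := by
    simp [mem_gridRect, hab, hcd]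
  rw [SimpleGraph.connected_iff_exists_forall_reachable]
  refine ⟨⟨_, corner⟩, ?_⟩
  suffices h : ∀ i j (hi : i < m) (hj : j < n)
      (hp : ((⟨i, hi⟩, ⟨j, hj⟩) : Fin m × Fin n) ∈ gridRect m n a b c d),
      ((gridGraph m n).induce (gridRect m n a b c d : Set (Fin m × Fin n))).Reachable
        ⟨_, hp⟩ ⟨_, corner⟩ from
    fun ⟨p, hp⟩ => (h p.1 p.2 p.1.2 p.2.2 hp).symm
  intro i
  induction i with
  | zero =>
    intro j
    induction j with
    | zero =>
      intro hi hj hp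
      obtain ⟨⟨h₁, -⟩, h₂, -⟩ := mem_gridRect.mp hp
      obtain rfl : a = 0 := Nat.le_zero.mp h₁
      obtain rfl : c = 0 := Nat.le_zero.mp h₂
      rfl
    | succ j ih =>
      intro hi hj hp
      have hp' := mem_gridRect.mp hp
      dsimp only at hp'
      by_cases hc : c = j + 1
      · obtain rfl : a = 0 := by omega
        subst hc
        rfl
      · have hq : ((⟨0, hi⟩, ⟨j, by omega⟩) : Fin m × Fin n) ∈ gridRect m n a b c d :=
          mem_gridRect.mpr (by dsimp only; omega)
        refine SimpleGraph.Reachable.trans (SimpleGraph.Adj.reachable ?_) (ih hi (by omega) hq)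
        exact gridGraph_adj_snd _ hj
  | succ i ih =>
    intro j
    by_cases ha : a = i + 1
    · subst ha
      induction j with
      | zero =>
        intro hi hj hp
        obtain ⟨-, h₂, -⟩ := mem_gridRect.mp hp
        obtain rfl : c = 0 := Nat.le_zero.mp h₂
        rfl
      | succ j ih =>
        intro hi hj hp
        have hp' := mem_gridRect.mp hp
        dsimp only at hp'
        by_cases hc : c = j + 1
        · subst hc
          rfl
        · have hq : ((⟨i + 1, hi⟩, ⟨j, by omega⟩) : Fin m × Fin n) ∈
              gridRect m n (i + 1) b c d := mem_gridRect.mpr (by dsimp only; omega)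
          refine SimpleGraph.Reachable.trans (SimpleGraph.Adj.reachable ?_) (ih hi (by omega) hq)
          exact gridGraph_adj_snd _ hj
    · intro hi hj hp
      have hp' := mem_gridRect.mp hp
      dsimp only at hp'
      have hq : ((⟨i, by omega⟩, ⟨j, hj⟩) : Fin m × Fin n) ∈ gridRect m n a b c d :=
        mem_gridRect.mpr (by dsimp only; omega)
      refine SimpleGraph.Reachable.trans (SimpleGraph.Adj.reachable ?_) (ih j (by omega) hj hq)
      exact gridGraph_adj_fst hi _

theorem half_mul_max_le_min {x y : ℕ} (hxy : x ≤ 2 * y) (hyx : y ≤ 2 * x) :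
    (1 / 2 : ℝ) * max (x : ℝ) y ≤ min (x : ℝ) y := by
  have h₁ : (x : ℝ) ≤ 2 * y := mod_cast hxy
  have h₂ : (y : ℝ) ≤ 2 * x := mod_cast hyx
  rcases le_total (x : ℝ) y with h | h
  · rw [max_eq_right h, min_eq_left h]
    linarith
  · rw [max_eq_left h, min_eq_right h]
    linarith

theorem gridRect_wellSep {m n : ℕ} (k : ℕ) : ∀ {a b c d : ℕ}, a < b → b ≤ m → c < d → d ≤ n →
    (b - a) + (d - c) ≤ k → WellSep (gridGraph m n) (1 / 2 : ℝ) (gridRect m n a b c d) := by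
  induction k with
  | zero => intro a b c d; omega
  | succ k ih =>
    intro a b c d hab hb hcd hd hk
    by_cases hfst : a + 1 < b
    · obtain ⟨e, he⟩ : ∃ e, e = (a + b) / 2 := ⟨_, rfl⟩
      refine .split _ (gridRect m n a e c d) (gridRect m n e b c d)
        (gridRect_nonempty (by omega) (by omega) hcd hd)
        (gridRect_nonempty (by omega) hb hcd hd) ?_ ?_
        (gridRect_connected (by omega) (by omega) hcd hd)
        (gridRect_connected (by omega) hb hcd hd) ?_
        (ih (by omega) (by omega) hcd hd (by omega)) (ih (by omega) hb hcd hd (by omega))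
      · exact Finset.disjoint_product.mpr (.inl (disjoint_finInterval m a e b))
      · rw [gridRect, gridRect, ← Finset.union_product,
          finInterval_union (by omega) (by omega), gridRect]
      · rw [card_gridRect (by omega) hd, card_gridRect hb hd]
        apply half_mul_max_le_min <;> rw [← mul_assoc] <;>
          exact Nat.mul_le_mul_right _ (by omega)
    · by_cases hsnd : c + 1 < d
      · obtain ⟨e, he⟩ : ∃ e, e = (c + d) / 2 := ⟨_, rfl⟩
        refine .split _ (gridRect m n a b c e) (gridRect m n a b e d)
          (gridRect_nonempty hab hb (by omega) (by omega))
          (gridRect_nonempty hab hb (by omega) hd) ?_ ?_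
          (gridRect_connected hab hb (by omega) (by omega))
          (gridRect_connected hab hb (by omega) hd) ?_
          (ih hab hb (by omega) (by omega) (by omega)) (ih hab hb (by omega) hd (by omega))
        · exact Finset.disjoint_product.mpr (.inr (disjoint_finInterval n c e d))
        · rw [gridRect, gridRect, ← Finset.product_union,
            finInterval_union (by omega) (by omega), gridRect]
        · rw [card_gridRect hb (by omega), card_gridRect hb hd]
          apply half_mul_max_le_min <;> rw [mul_left_comm] <;>
            exact Nat.mul_le_mul_left _ (by omega)
      · refine .small _ ?_
        rw [card_gridRect hb hd, show b - a = 1 by omega, show d - c = 1 by omega]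

/-- for all `m, n ≥ 1`, the `m × n` grid graph is well separable with
parameter `1/2`. -/
theorem gridGraph_wellSep (m n : ℕ) (hm : 1 ≤ m) (hn : 1 ≤ n) :
    WellSep (gridGraph m n) (1 / 2 : ℝ) Finset.univ := by
  have h : gridRect m n 0 m 0 n = Finset.univ := by
    ext p
    simp [mem_gridRect]
  exact h ▸ gridRect_wellSep _ hm le_rfl hn le_rfl le_rfl
end

section
/- Let U be the 4×4 matrix (1/2)·[[1,1,1,1],[1,i,−1,−i],[1,−1,1,−1],[1,−i,−1,i]] (the 2-qubit Quantum Fourier Transform), and let M be the matrix product (I⊗Rx(π)) · (I⊗Rz(π)) · (I⊗Ry(−π/2)) · (Rz(−3π/4)⊗Rz(−3π/4)) · ZZ(−π/4) · (Ry(π/2)⊗I) · (Rz(−π)⊗I) · (Rx(π)⊗I), where I is the 2×2 identity matrix. Then there exist a real number θ and a matrix Q that is either the 4×4 identity or the 4×4 qubit-swap matrix (acting on basis states by |a b⟩ ↦ |b a⟩) such that Q · M = e^{iθ} · U; that is, M equals U up to a global phase and a permutation of the output qubits. -/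
open Matrix Kronecker Complex Real

noncomputable section

/-- Single-qubit rotation `Rx(θ) = [[cos(θ/2), -i sin(θ/2)], [-i sin(θ/2), cos(θ/2)]]`. -/
def Rx (θ : ℝ) : Matrix (Fin 2) (Fin 2) ℂ :=
  !![Complex.cos ((θ : ℂ) / 2), -Complex.I * Complex.sin ((θ : ℂ) / 2);
     -Complex.I * Complex.sin ((θ : ℂ) / 2), Complex.cos ((θ : ℂ) / 2)]

/-- Single-qubit rotation `Ry(θ) = [[cos(θ/2), -sin(θ/2)], [sin(θ/2), cos(θ/2)]]`. -/
def Ry (θ : ℝ) : Matrix (Fin 2) (Fin 2) ℂ :=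
  !![Complex.cos ((θ : ℂ) / 2), -Complex.sin ((θ : ℂ) / 2);
     Complex.sin ((θ : ℂ) / 2), Complex.cos ((θ : ℂ) / 2)]

/-- Single-qubit rotation `Rz(θ) = diag(e^{-iθ/2}, e^{iθ/2})`. -/
def Rz (θ : ℝ) : Matrix (Fin 2) (Fin 2) ℂ :=
  !![Complex.exp (-(θ : ℂ) * Complex.I / 2), 0;
     0, Complex.exp ((θ : ℂ) * Complex.I / 2)]

/-- The two-qubit gate `ZZ(θ) = diag(e^{-iθ/2}, e^{iθ/2}, e^{iθ/2}, e^{-iθ/2})`, indexed by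
pairs of qubit values (basis order `|00⟩, |01⟩, |10⟩, |11⟩`). -/
def ZZ (θ : ℝ) : Matrix (Fin 2 × Fin 2) (Fin 2 × Fin 2) ℂ :=
  Matrix.diagonal (fun p => if p.1 = p.2 then Complex.exp (-(θ : ℂ) * Complex.I / 2)
    else Complex.exp ((θ : ℂ) * Complex.I / 2))

/-- The 2-qubit Quantum Fourier Transform
`U = (1/2)·[[1,1,1,1],[1,i,-1,-i],[1,-1,1,-1],[1,-i,-1,i]]`: its entry in row `(a,b)` and
column `(c,d)` (basis order `|00⟩, |01⟩, |10⟩, |11⟩`, i.e. row index `2a+b`, column index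
`2c+d`) is `(1/2)·i^{(2a+b)(2c+d)}`. -/
def QFT2 : Matrix (Fin 2 × Fin 2) (Fin 2 × Fin 2) ℂ :=
  fun p q => (1 / 2 : ℂ) *
    Complex.I ^ ((2 * (p.1 : ℕ) + (p.2 : ℕ)) * (2 * (q.1 : ℕ) + (q.2 : ℕ)))

/-- The qubit-swap matrix, acting on basis states by `|a b⟩ ↦ |b a⟩`. -/
def swapQubits : Matrix (Fin 2 × Fin 2) (Fin 2 × Fin 2) ℂ :=
  fun p q => if p.1 = q.2 ∧ p.2 = q.1 then 1 else 0

theorem Rx_pi : Rx π = !![0, -I; -I, 0] := by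
  simp [Rx]

theorem Rz_pi : Rz π = !![-I, 0; 0, I] := by
  have h : (π : ℂ) * I / 2 = π / 2 * I := by ring
  simp [Rz, neg_div, Complex.exp_neg, h, Complex.exp_pi_div_two_mul_I]

theorem Rz_neg_pi : Rz (-π) = !![I, 0; 0, -I] := by
  have h : (π : ℂ) * I / 2 = π / 2 * I := by ring
  simp [Rz, neg_div, Complex.exp_neg, h, Complex.exp_pi_div_two_mul_I]

theorem complex_cos_pi_div_two_div_two : Complex.cos ((π : ℂ) / 2 / 2) = ((√2 / 2 : ℝ) : ℂ) := by
  rw [← Real.cos_pi_div_four, Complex.ofReal_cos]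
  push_cast
  ring_nf

theorem complex_sin_pi_div_two_div_two : Complex.sin ((π : ℂ) / 2 / 2) = ((√2 / 2 : ℝ) : ℂ) := by
  rw [← Real.sin_pi_div_four, Complex.ofReal_sin]
  push_cast
  ring_nf

theorem Ry_pi_div_two : Ry (π / 2) = ((√2 / 2 : ℝ) : ℂ) • !![1, -1; 1, 1] := by
  have hc := complex_cos_pi_div_two_div_two
  have hs := complex_sin_pi_div_two_div_two
  ext i j
  fin_cases i <;> fin_cases j <;> simp [Ry, hc, hs]

theorem Ry_neg_pi_div_two : Ry (-(π / 2)) = ((√2 / 2 : ℝ) : ℂ) • !![1, 1; -1, 1] := by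
  have hc := complex_cos_pi_div_two_div_two
  have hs := complex_sin_pi_div_two_div_two
  ext i j
  fin_cases i <;> fin_cases j <;> simp [Ry, neg_div, hc, hs]

/-- The three gates applied last all act on the second qubit. -/
theorem Rx_pi_mul_Rz_pi_mul_Ry_neg_pi_div_two :
    Rx π * Rz π * Ry (-(π / 2)) = ((√2 / 2 : ℝ) : ℂ) • !![-1, 1; -1, -1] := by
  rw [Rx_pi, Rz_pi, Ry_neg_pi_div_two, Matrix.mul_smul]
  simp

/-- The three gates applied first all act on the first qubit. -/
theorem Ry_pi_div_two_mul_Rz_neg_pi_mul_Rx_pi :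
    Ry (π / 2) * Rz (-π) * Rx π = ((√2 / 2 : ℝ) : ℂ) • !![1, 1; -1, 1] := by
  rw [Rx_pi, Rz_neg_pi, Ry_pi_div_two, Matrix.smul_mul, Matrix.smul_mul]
  simp

theorem exp_neg_pi_div_eight_mul_I_pow_four : Complex.exp (-(π / 8) * I) ^ 4 = -I := by
  rw [← Complex.exp_nat_mul, show ((4 : ℕ) : ℂ) * (-(π / 8) * I) = -(π / 2 * I) by push_cast; ring,
    Complex.exp_neg, Complex.exp_pi_div_two_mul_I, Complex.inv_I]

theorem exp_pi_div_eight_mul_I :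
    Complex.exp (π / 8 * I) = I * Complex.exp (-(π / 8) * I) ^ 3 := by
  rw [← Complex.exp_nat_mul, show (π / 8 * I : ℂ) = π / 2 * I + (3 : ℕ) * (-(π / 8) * I) by
    push_cast; ring, Complex.exp_add, Complex.exp_pi_div_two_mul_I]

theorem Rz_neg_three_pi_div_four : Rz (-(3 * π / 4)) =
    !![I * Complex.exp (-(π / 8) * I), 0; 0, Complex.exp (-(π / 8) * I) ^ 3] := by
  have h₁ : Complex.exp (3 * π / 4 * I / 2) = I * Complex.exp (-(π / 8) * I) := by
    rw [show (3 * π / 4 * I / 2 : ℂ) = π / 2 * I + -(π / 8) * I by ring, Complex.exp_add,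
      Complex.exp_pi_div_two_mul_I]
  have h₂ : Complex.exp (-(3 * π / 4) * I / 2) = Complex.exp (-(π / 8) * I) ^ 3 := by
    rw [← Complex.exp_nat_mul]
    congr 1
    push_cast
    ring
  rw [← h₁, ← h₂]
  simp [Rz]

theorem ZZ_neg_pi_div_four : ZZ (-(π / 4)) = Matrix.diagonal fun p =>
    if p.1 = p.2 then I * Complex.exp (-(π / 8) * I) ^ 3 else Complex.exp (-(π / 8) * I) := by
  rw [← exp_pi_div_eight_mul_I, ZZ]
  congr 1
  funext p
  congr 2
  all_goals
    push_cast
    ring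

theorem swapQubits_mul_apply (A : Matrix (Fin 2 × Fin 2) (Fin 2 × Fin 2) ℂ)
    (p q : Fin 2 × Fin 2) : (swapQubits * A) p q = A p.swap q := by
  rw [Matrix.mul_apply, Finset.sum_eq_single p.swap]
  · simp [swapQubits]
  · intro r _ hr
    have : ¬(p.1 = r.2 ∧ p.2 = r.1) := fun h => hr (Prod.ext h.2.symm h.1.symm)
    simp [swapQubits, this]
  · simp

/-- the NMR pulse sequence
`(I⊗Rx(π))·(I⊗Rz(π))·(I⊗Ry(-π/2))·(Rz(-3π/4)⊗Rz(-3π/4))·ZZ(-π/4)·(Ry(π/2)⊗I)·(Rz(-π)⊗I)·(Rx(π)⊗I)`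
implements the 2-qubit Quantum Fourier Transform up to a global phase and a permutation of
the output qubits. -/
theorem nmr_pulse_sequence_implements_qft2 :
    ∃ (θ : ℝ) (Q : Matrix (Fin 2 × Fin 2) (Fin 2 × Fin 2) ℂ),
      (Q = 1 ∨ Q = swapQubits) ∧
      Q * (((1 : Matrix (Fin 2) (Fin 2) ℂ) ⊗ₖ Rx π) *
           ((1 : Matrix (Fin 2) (Fin 2) ℂ) ⊗ₖ Rz π) *
           ((1 : Matrix (Fin 2) (Fin 2) ℂ) ⊗ₖ Ry (-(π / 2))) *
           (Rz (-(3 * π / 4)) ⊗ₖ Rz (-(3 * π / 4))) *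
           ZZ (-(π / 4)) *
           (Ry (π / 2) ⊗ₖ (1 : Matrix (Fin 2) (Fin 2) ℂ)) *
           (Rz (-π) ⊗ₖ (1 : Matrix (Fin 2) (Fin 2) ℂ)) *
           (Rx π ⊗ₖ (1 : Matrix (Fin 2) (Fin 2) ℂ))) =
        Complex.exp ((θ : ℂ) * Complex.I) • QFT2 := by
  refine ⟨-(π / 8), swapQubits, Or.inr rfl, ?_⟩
  have hr : (((√2 / 2 : ℝ) : ℂ)) ^ 2 = 1 / 2 := by
    rw [← Complex.ofReal_pow, div_pow, Real.sq_sqrt (by norm_num)]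
    norm_num
  have hv := exp_neg_pi_div_eight_mul_I_pow_four
  have hleft (A B C : Matrix (Fin 2) (Fin 2) ℂ) :
      ((1 : Matrix (Fin 2) (Fin 2) ℂ) ⊗ₖ A) * ((1 : Matrix (Fin 2) (Fin 2) ℂ) ⊗ₖ B) *
        ((1 : Matrix (Fin 2) (Fin 2) ℂ) ⊗ₖ C) = 1 ⊗ₖ (A * B * C) := by
    simp [← Matrix.mul_kronecker_mul]
  have hright (S : Matrix (Fin 2 × Fin 2) (Fin 2 × Fin 2) ℂ) (A B C : Matrix (Fin 2) (Fin 2) ℂ) :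
      S * (A ⊗ₖ (1 : Matrix (Fin 2) (Fin 2) ℂ)) * (B ⊗ₖ (1 : Matrix (Fin 2) (Fin 2) ℂ)) *
        (C ⊗ₖ (1 : Matrix (Fin 2) (Fin 2) ℂ)) = S * ((A * B * C) ⊗ₖ 1) := by
    simp [Matrix.mul_assoc, ← Matrix.mul_kronecker_mul]
  rw [hleft, hright,
    Rx_pi_mul_Rz_pi_mul_Ry_neg_pi_div_two, Ry_pi_div_two_mul_Rz_neg_pi_mul_Rx_pi,
    Rz_neg_three_pi_div_four, ZZ_neg_pi_div_four,
    show ((-(π / 8) : ℝ) : ℂ) * I = -(π / 8) * I by push_cast; rfl]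
  generalize ((√2 / 2 : ℝ) : ℂ) = r at hr ⊢
  generalize Complex.exp (-(π / 8) * I) = v at hv ⊢
  have hI := Complex.I_sq
  ext ⟨a, b⟩ ⟨c, d⟩
  rw [swapQubits_mul_apply]
  fin_cases a <;> fin_cases b <;> fin_cases c <;> fin_cases d <;>
    simp [Matrix.mul_apply, Fintype.sum_prod_type, Matrix.diagonal_apply, QFT2] <;>
    grind

end
end
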